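/- arXiv:1502.04332 — 3 statements merged into one kernel-verified Lean document; each statement's English description precedes it below -/
import Mathlib

section
/- Let n ≥ 4 be an integer, p a prime, and C₀ = [c_{i,j}] a matrix in R₀^(n)(p). If c_{i,j} = 0 for all pairs (i,j) with 2 ≤ i < j ≤ n−1, then C₀·D^(n)(p) belongs to the double coset Λ_n diag(p, p², …, p², p³) Λ_n (with n−2 middle entries equal to p²). Otherwise, C₀·D^(n)(p) belongs to the double coset Λ_n diag(p, p, p², …, p², p³, p³) Λ_n (with n−4 entries equal to p²). -/
open Matrix

/-- `Λ_n = GL_n(ℤ)` viewed inside the `n × n` rational matrices: the matrices with integer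
entries whose determinant is `±1`. -/
def Lambda (n : ℕ) : Set (Matrix (Fin n) (Fin n) ℚ) :=
  {γ | (∀ i j, ∃ z : ℤ, γ i j = (z : ℚ)) ∧ (γ.det = 1 ∨ γ.det = -1)}

/-- The right coset `Λ_n h = {γ * h : γ ∈ Λ_n}`. -/
def rightCoset (n : ℕ) (h : Matrix (Fin n) (Fin n) ℚ) : Set (Matrix (Fin n) (Fin n) ℚ) :=
  {m | ∃ γ ∈ Lambda n, m = γ * h}

/-- The double coset `Λ_n g Λ_n = {γ₁ * g * γ₂ : γ₁, γ₂ ∈ Λ_n}`. -/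
def doubleCoset (n : ℕ) (g : Matrix (Fin n) (Fin n) ℚ) : Set (Matrix (Fin n) (Fin n) ℚ) :=
  {m | ∃ γ₁ ∈ Lambda n, ∃ γ₂ ∈ Lambda n, m = γ₁ * g * γ₂}

/-- The degree of `g`: the number of distinct right cosets `Λ_n h` contained in `Λ_n g Λ_n`. -/
noncomputable def degree (n : ℕ) (g : Matrix (Fin n) (Fin n) ℚ) : ℕ :=
  Set.ncard {S : Set (Matrix (Fin n) (Fin n) ℚ) | ∃ h ∈ doubleCoset n g, S = rightCoset n h}

/-- The `k`-th determinantal divisor of an `n × n` integer matrix: the gcd of all of its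
`k × k` minors (which is `0` when all these minors vanish), a minor being indexed by a pair
of strictly increasing maps `Fin k → Fin n` selecting rows and columns. -/
def detDiv (n k : ℕ) (C : Matrix (Fin n) (Fin n) ℤ) : ℤ :=
  Finset.gcd ((Finset.univ : Finset ((Fin k → Fin n) × (Fin k → Fin n))).filter
      (fun fg => (∀ a b : Fin k, a < b → fg.1 a < fg.1 b) ∧
        (∀ a b : Fin k, a < b → fg.2 a < fg.2 b)))
    (fun fg => (C.submatrix fg.1 fg.2).det)

/-- `D^(n)(p) = diag(1, p, …, p, p²)` with `n - 2` middle diagonal entries equal to `p`. -/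
def Dmat (n p : ℕ) : Matrix (Fin n) (Fin n) ℤ :=
  Matrix.diagonal (fun i => if i.val = 0 then 1 else if i.val = n - 1 then (p : ℤ) ^ 2 else (p : ℤ))

/-- The set `R₀^(n)(p)` of upper-triangular integer matrices whose determinantal divisors are
`d_k = p^(k-1)` for `1 ≤ k ≤ n - 1` and `d_n = p^n`, whose diagonal entries all equal `p`, and
whose above-diagonal entries lie in `[0, p)`. -/
def R0 (n p : ℕ) : Set (Matrix (Fin n) (Fin n) ℤ) :=
  {C | (∀ i j : Fin n, j < i → C i j = 0) ∧
    (∀ k : ℕ, 1 ≤ k → k ≤ n - 1 → detDiv n k C = (p : ℤ) ^ (k - 1)) ∧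
    detDiv n n C = (p : ℤ) ^ n ∧
    (∀ i : Fin n, C i i = (p : ℤ)) ∧
    (∀ i j : Fin n, i < j → 0 ≤ C i j ∧ C i j < (p : ℤ))}

/-- The set `R₁^(n)(p)` of upper-triangular integer matrices whose diagonal entries lie in
`{1, p, p²}` with exactly one entry `1` and exactly one entry `p²`, whose above-diagonal
entries satisfy `0 ≤ c i j < c j j`, and such that `p ∣ c i i` implies `p ∣ c i j` for `j > i`. -/
def R1 (n p : ℕ) : Set (Matrix (Fin n) (Fin n) ℤ) :=
  {C | (∀ i j : Fin n, j < i → C i j = 0) ∧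
    (∀ i : Fin n, C i i = 1 ∨ C i i = (p : ℤ) ∨ C i i = (p : ℤ) ^ 2) ∧
    (∃! i : Fin n, C i i = 1) ∧
    (∃! i : Fin n, C i i = (p : ℤ) ^ 2) ∧
    (∀ i j : Fin n, i < j → 0 ≤ C i j ∧ C i j < C j j) ∧
    (∀ i j : Fin n, i < j → (p : ℤ) ∣ C i i → (p : ℤ) ∣ C i j)}

/-- Casting an integer matrix to a rational matrix. -/
def toQ (n : ℕ) (C : Matrix (Fin n) (Fin n) ℤ) : Matrix (Fin n) (Fin n) ℚ :=
  C.map (fun z : ℤ => (z : ℚ))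

open Finset in
theorem exists_equiv_comp_eq_of_card_zero_eq {ι : Type*} [Fintype ι] (e g : ι → ℕ)
    (he : ∀ i, e i ≤ 2) (hg : ∀ i, g i ≤ 2) (hsum : ∑ i, e i = ∑ i, g i)
    (hzero : #{i | e i = 0} = #{i | g i = 0}) : ∃ σ : ι ≃ ι, ∀ i, g (σ i) = e i := by
  have key : ∀ f : ι → ℕ, (∀ i, f i ≤ 2) → #{i | f i = 0} + #{i | f i = 1} + #{i | f i = 2} =
      Fintype.card ι ∧ #{i | f i = 1} + 2 * #{i | f i = 2} = ∑ i, f i := by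
    intro f hf
    simp only [card_filter, Fintype.card_eq_sum_ones, mul_sum, ← sum_add_distrib]
    constructor <;> refine sum_congr rfl fun i _ => ?_ <;>
      (have := hf i; interval_cases f i <;> rfl)
  have hcard : ∀ c, #{i | e i = c} = #{i | g i = c} := by
    obtain ⟨h₁, h₂⟩ := key e he
    obtain ⟨h₃, h₄⟩ := key g hg
    intro c
    rcases Nat.lt_or_ge 2 c with hc | hc
    · rw [filter_eq_empty_iff.2 fun i _ => ((he i).trans_lt hc).ne,
        filter_eq_empty_iff.2 fun i _ => ((hg i).trans_lt hc).ne]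
    · interval_cases c <;> omega
  refine ⟨Equiv.ofFiberEquiv (f := e) (g := g) fun c => Fintype.equivOfCardEq ?_,
    fun i => Equiv.ofFiberEquiv_map _ i⟩
  rw [Fintype.card_subtype, Fintype.card_subtype, hcard]

theorem Matrix.exists_eq_mul_diagonal_mul {ι R : Type*} [Fintype ι] [DecidableEq ι] [CommRing R]
    [IsDomain R] [IsPrincipalIdealRing R] (A : Matrix ι ι R) (hA : A.det ≠ 0) :
    ∃ (P Q : Matrix ι ι R) (a : ι → R), IsUnit P.det ∧ IsUnit Q.det ∧
      A = P * diagonal a * Q := by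
  have hinj : Function.Injective A.mulVecLin := by
    intro v w hvw
    exact Matrix.mulVec_injective_of_det_ne_zero hA hvw
  let E := LinearEquiv.ofInjective A.mulVecLin hinj
  obtain ⟨b, a, c, hc⟩ := Submodule.exists_smith_normal_form_of_rank_eq (Pi.basisFun R ι)
    E.finrank_eq.symm
  let c' := c.map E.symm
  have hc' (i : ι) : A.mulVec (c' i) = a i • b i := by
    rw [← hc i]
    exact congrArg Subtype.val (E.apply_symm_apply (c i))
  let _ := (Pi.basisFun R ι).invertibleToMatrix c'
  let _ := (Pi.basisFun R ι).invertibleToMatrix b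
  have hQ : IsUnit ((Pi.basisFun R ι).toMatrix c').det := isUnit_det_of_invertible _
  refine ⟨(Pi.basisFun R ι).toMatrix b, ((Pi.basisFun R ι).toMatrix c')⁻¹, a,
    isUnit_det_of_invertible _, isUnit_nonsing_inv_det _ hQ, ?_⟩
  have hAQ : A * (Pi.basisFun R ι).toMatrix c' =
      (Pi.basisFun R ι).toMatrix b * diagonal a := by
    ext k i
    have := congrFun (hc' i) k
    rw [mul_diagonal]
    simpa [Matrix.mul_apply, Matrix.mulVec, dotProduct, Module.Basis.toMatrix_apply,
      mul_comm] using this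
  rw [← hAQ, mul_nonsing_inv_cancel_right _ _ hQ]

open Finset in
theorem Matrix.exists_eq_mul_diagonal_pow_mul {ι : Type*} [Fintype ι] [DecidableEq ι] {p : ℕ}
    (hp : p.Prime) (A B : Matrix ι ι ℤ) (g : ι → ℕ) (hg : ∀ i, g i ≤ 2)
    (hdet : A.det = (p : ℤ) ^ ∑ i, g i) (hAB : A * B = (p : ℤ) ^ 2 • 1)
    (hrank : (A.map (Int.castRingHom (ZMod p))).rank = #{i | g i = 0}) :
    ∃ P Q : Matrix ι ι ℤ, IsUnit P.det ∧ IsUnit Q.det ∧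
      A = P * diagonal (fun i => (p : ℤ) ^ g i) * Q := by
  have : Fact p.Prime := ⟨hp⟩
  have hp' : Prime (p : ℤ) := Nat.prime_iff_prime_int.1 hp
  obtain ⟨P, Q, a, hP, hQ, rfl⟩ := A.exists_eq_mul_diagonal_mul
    (by rw [hdet]; exact pow_ne_zero _ hp'.ne_zero)
  have ha (i : ι) : a i ∣ (p : ℤ) ^ 2 := by
    have h : diagonal a * (Q * B * P) = (p : ℤ) ^ 2 • 1 := by
      calc diagonal a * (Q * B * P) = P⁻¹ * (P * diagonal a * Q * B) * P := by
            simp only [Matrix.mul_assoc, nonsing_inv_mul_cancel_left _ _ hP]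
        _ = (p : ℤ) ^ 2 • 1 := by
            rw [hAB, Matrix.mul_smul, mul_one, smul_mul, nonsing_inv_mul _ hP]
    have h' := congrFun (congrFun h i) i
    rw [diagonal_mul] at h'
    exact ⟨_, by simpa using h'.symm⟩
  choose e he u hu using fun i => (dvd_prime_pow hp' 2).1 (ha i)
  have hau (i : ι) : a i = (p : ℤ) ^ e i * ((u i)⁻¹ : ℤˣ) := by
    rw [← hu, Units.mul_inv_cancel_right]
  have hsum : ∑ i, e i = ∑ i, g i := by
    have h := congrArg Int.natAbs hdet
    simp only [det_mul, det_diagonal, Int.natAbs_mul, Int.isUnit_iff_natAbs_eq.1 hP,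
      Int.isUnit_iff_natAbs_eq.1 hQ, hau, prod_mul_distrib, prod_pow_eq_pow_sum, Int.natAbs_pow,
      Int.natAbs_natCast, one_mul, mul_one] at h
    rw [← Units.coe_prod, Int.natAbs_of_isUnit (Units.isUnit _), mul_one] at h
    exact Nat.pow_right_injective hp.two_le h
  have hzero : #{i | e i = 0} = #{i | g i = 0} := by
    rw [← hrank, Matrix.map_mul, Matrix.map_mul, rank_mul_eq_left_of_isUnit_det,
      rank_mul_eq_right_of_isUnit_det, diagonal_map (map_zero _), rank_diagonal,
      Fintype.card_subtype]
    · congr 1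
      refine filter_congr fun i _ => ?_
      rw [hau]
      have hu' : (((u i : ℤˣ) : ℤ) : ZMod p) ≠ 0 :=
        ((Units.isUnit _).map (Int.castRingHom (ZMod p))).ne_zero
      simp [hu']
    · rw [← RingHom.mapMatrix_apply, ← RingHom.map_det]
      exact hP.map _
    · rw [← RingHom.mapMatrix_apply, ← RingHom.map_det]
      exact hQ.map _
  obtain ⟨σ, hσ⟩ := exists_equiv_comp_eq_of_card_zero_eq e g he hg hsum hzero
  have hperm : IsUnit (σ.toPEquiv.toMatrix : Matrix ι ι ℤ).det := by
    rw [← Equiv.Perm.permMatrix, det_permutation]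
    exact Units.isUnit _
  have hperm' : IsUnit (σ.symm.toPEquiv.toMatrix : Matrix ι ι ℤ).det := by
    rw [← Equiv.Perm.permMatrix, det_permutation]
    exact Units.isUnit _
  have hunit : IsUnit (diagonal fun i => (((u i)⁻¹ : ℤˣ) : ℤ)).det := by
    rw [det_diagonal, ← Units.coe_prod]
    exact Units.isUnit _
  refine ⟨P * σ.toPEquiv.toMatrix,
    σ.symm.toPEquiv.toMatrix * diagonal (fun i => (((u i)⁻¹ : ℤˣ) : ℤ)) * Q,
    by rw [det_mul]; exact hP.mul hperm,
    by rw [det_mul, det_mul]; exact (hperm'.mul hunit).mul hQ, ?_⟩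
  have hconj : (σ.toPEquiv.toMatrix : Matrix ι ι ℤ) * diagonal (fun i => (p : ℤ) ^ g i) *
      σ.symm.toPEquiv.toMatrix = diagonal fun i => (p : ℤ) ^ e i := by
    rw [PEquiv.toMatrix_toPEquiv_mul, PEquiv.mul_toMatrix_toPEquiv]
    ext i j
    simp [diagonal_apply, hσ]
  have ha' : diagonal a = (diagonal fun i => (p : ℤ) ^ e i) *
      diagonal fun i => (((u i)⁻¹ : ℤˣ) : ℤ) := by
    rw [diagonal_mul_diagonal]
    exact congrArg diagonal (funext hau)
  rw [ha', ← hconj]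
  simp only [Matrix.mul_assoc]

theorem dvd_detDiv_minor {n k : ℕ} (C : Matrix (Fin n) (Fin n) ℤ) (f g : Fin k → Fin n)
    (hf : StrictMono f) (hg : StrictMono g) : detDiv n k C ∣ (C.submatrix f g).det :=
  Finset.gcd_dvd (b := (f, g)) (by simpa using ⟨fun _ _ h => hf h, fun _ _ h => hg h⟩)

theorem detDiv_two_dvd {n : ℕ} (C : Matrix (Fin n) (Fin n) ℤ) (i i' j j' : Fin n) :
    detDiv n 2 C ∣ C i j * C i' j' - C i j' * C i' j := by
  have key (a a' b b' : Fin n) (ha : a < a') (hb : b < b') :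
      detDiv n 2 C ∣ C a b * C a' b' - C a b' * C a' b := by
    have h := dvd_detDiv_minor C ![a, a'] ![b, b'] (by simpa [strictMono_vecCons] using ha)
      (by simpa [strictMono_vecCons] using hb)
    rw [det_fin_two] at h
    simpa using h
  rcases lt_trichotomy i i' with hi | rfl | hi <;> rcases lt_trichotomy j j' with hj | rfl | hj
  · exact key _ _ _ _ hi hj
  · simp
  · have := key _ _ _ _ hi hj
    rwa [← dvd_neg, neg_sub] at this
  · simp [mul_comm]
  · simp
  · simp [mul_comm]
  · have := key _ _ _ _ hi hj
    rwa [← dvd_neg, neg_sub, mul_comm, mul_comm (C i' j)] at this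
  · simp
  · have := key _ _ _ _ hi hj
    rwa [mul_comm, mul_comm (C i' j)] at this

theorem exists_adjugate_eq_smul {n : ℕ} (C : Matrix (Fin (n + 1)) (Fin (n + 1)) ℤ) :
    ∃ X, C.adjugate = detDiv (n + 1) n C • X := by
  have h (i j : Fin (n + 1)) : detDiv (n + 1) n C ∣ C.adjugate i j := by
    rw [adjugate_fin_succ_eq_det_submatrix]
    exact (dvd_detDiv_minor C _ _ (Fin.strictMono_succAbove _)
      (Fin.strictMono_succAbove _)).mul_left _
  choose X hX using h
  exact ⟨X, by ext i j; exact hX i j⟩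

theorem toQ_mem_Lambda {n : ℕ} {P : Matrix (Fin n) (Fin n) ℤ} (hP : IsUnit P.det) :
    toQ n P ∈ Lambda n := by
  refine ⟨fun i j => ⟨P i j, rfl⟩, ?_⟩
  have h : (toQ n P).det = (P.det : ℚ) := ((Int.castRingHom ℚ).map_det P).symm
  rcases Int.isUnit_iff.1 hP with h' | h' <;> simp [h, h']

/-- The quotient `p⁻¹ C D^(n)(p)` for an upper triangular `C` with diagonal entries `p`. -/
def scaledProduct (m p : ℕ) (C : Matrix (Fin (m + 2)) (Fin (m + 2)) ℤ) :
    Matrix (Fin (m + 2)) (Fin (m + 2)) ℤ :=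
  Matrix.of fun i j => if j = 0 then (if i = 0 then 1 else 0) else
    if j = Fin.last _ then p * C i j else C i j

theorem smul_scaledProduct {m p : ℕ} {C : Matrix (Fin (m + 2)) (Fin (m + 2)) ℤ}
    (hC : C ∈ R0 (m + 2) p) : (p : ℤ) • scaledProduct m p C = C * Dmat (m + 2) p := by
  obtain ⟨hlow, -, -, hdiag, -⟩ := hC
  ext i j
  rw [Dmat, mul_diagonal, Matrix.smul_apply, scaledProduct, of_apply, smul_eq_mul]
  by_cases hj : j = 0
  · subst hj
    by_cases hi : i = 0
    · simp [hi, hdiag]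
    · simp [hi, hlow i 0 (Fin.pos_of_ne_zero hi)]
  · by_cases hl : j = Fin.last _
    · subst hl
      simp [hj]
      ring
    · have h0 : (j : ℕ) ≠ 0 := fun h => hj (Fin.ext h)
      have h1 : (j : ℕ) ≠ m + 1 := fun h => hl (Fin.ext h)
      simp [hj, hl, h0, h1, mul_comm]

theorem det_scaledProduct {m p : ℕ} {C : Matrix (Fin (m + 2)) (Fin (m + 2)) ℤ}
    (hC : C ∈ R0 (m + 2) p) : (scaledProduct m p C).det = (p : ℤ) ^ (m + 2) := by
  obtain ⟨hlow, -, -, hdiag, -⟩ := hC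
  rw [det_of_isUpperTriangular, Fin.prod_univ_succ, Fin.prod_univ_castSucc]
  · simp [scaledProduct, hdiag, Fin.succ_ne_zero, ← Fin.succ_last, Fin.succ_inj,
      Fin.castSucc_ne_last]
    ring
  · intro i j hij
    have hij : j < i := hij
    simp [scaledProduct, hlow i j hij]
    intro h h'
    omega

theorem exists_scaledProduct_mul_eq {m p : ℕ} (hp : p ≠ 0)
    {C : Matrix (Fin (m + 2)) (Fin (m + 2)) ℤ} (hC : C ∈ R0 (m + 2) p) :
    ∃ B, scaledProduct m p C * B = (p : ℤ) ^ 2 • 1 := by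
  have hsm := smul_scaledProduct hC
  obtain ⟨hlow, hdiv, -, hdiag, -⟩ := hC
  have hp0 : (p : ℤ) ≠ 0 := by exact_mod_cast hp
  have hdet : C.det = (p : ℤ) ^ (m + 2) := by
    rw [det_of_isUpperTriangular fun i j hij => hlow i j hij]
    simp [hdiag]
  obtain ⟨X, hX⟩ := exists_adjugate_eq_smul C
  rw [hdiv (m + 1) (by omega) (by omega), Nat.add_sub_cancel] at hX
  have hCX : C * X = (p : ℤ) ^ 2 • 1 := by
    have h := mul_adjugate C
    rw [hX, hdet, Matrix.mul_smul, pow_add, mul_smul] at h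
    exact smul_right_injective _ (pow_ne_zero m hp0) h
  have hlast (j) : X (Fin.last _) j = if Fin.last _ = j then (p : ℤ) else 0 := by
    have h := congrFun (congrFun hCX (Fin.last _)) j
    rw [mul_apply, Finset.sum_eq_single (Fin.last _), hdiag] at h
    · refine mul_left_cancel₀ hp0 (h.trans ?_)
      simp [one_apply, sq]
    · intro k _ hk
      rw [hlow _ _ (Fin.lt_last_iff_ne_last.2 hk), zero_mul]
    · simp
  let B : Matrix (Fin (m + 2)) (Fin (m + 2)) ℤ := Matrix.of fun i j =>
    if i = 0 then p * X i j else if i = Fin.last _ then (if Fin.last _ = j then 1 else 0) else X i j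
  have hDB : Dmat (m + 2) p * B = (p : ℤ) • X := by
    ext i j
    rw [Dmat, diagonal_mul, Matrix.smul_apply, smul_eq_mul]
    simp only [B, of_apply]
    by_cases hi : i = 0
    · simp [hi]
    · by_cases hl : i = Fin.last _
      · subst hl
        simp [hi, hlast, sq]
      · have h0 : (i : ℕ) ≠ 0 := fun h => hi (Fin.ext h)
        have h1 : (i : ℕ) ≠ m + 1 := fun h => hl (Fin.ext h)
        simp [hi, hl, h0, h1]
  refine ⟨B, smul_right_injective _ hp0 ?_⟩
  simp only
  rw [← smul_mul, hsm, Matrix.mul_assoc, hDB, Matrix.mul_smul, hCX]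

theorem scaledProduct_mem_doubleCoset {m p : ℕ} (hp : p.Prime)
    {C : Matrix (Fin (m + 2)) (Fin (m + 2)) ℤ} (hC : C ∈ R0 (m + 2) p) (g : Fin (m + 2) → ℕ)
    (hg : ∀ i, g i ≤ 2) (hsum : ∑ i, g i = m + 2)
    (hrank : ((scaledProduct m p C).map (Int.castRingHom (ZMod p))).rank =
      Finset.card {i | g i = 0}) :
    toQ (m + 2) (C * Dmat (m + 2) p) ∈
      doubleCoset (m + 2) (diagonal fun i => (p : ℚ) ^ (g i + 1)) := by
  obtain ⟨B, hB⟩ := exists_scaledProduct_mul_eq hp.ne_zero hC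
  obtain ⟨P, Q, hP, hQ, h⟩ := exists_eq_mul_diagonal_pow_mul hp _ B g hg
    (by rw [hsum, det_scaledProduct hC]) hB hrank
  refine ⟨_, toQ_mem_Lambda hP, _, toQ_mem_Lambda hQ, ?_⟩
  have hd : (diagonal fun i => (p : ℚ) ^ (g i + 1)) =
      toQ (m + 2) ((p : ℤ) • diagonal (fun i => (p : ℤ) ^ g i)) := by
    ext i j
    simp only [toQ, map_apply, Matrix.smul_apply, diagonal_apply, smul_eq_mul]
    split_ifs <;> simp [pow_succ']
  have hmul (M N : Matrix (Fin (m + 2)) (Fin (m + 2)) ℤ) :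
      toQ (m + 2) M * toQ (m + 2) N = toQ (m + 2) (M * N) :=
    (Matrix.map_mul (f := Int.castRingHom ℚ)).symm
  rw [hd, hmul, hmul, ← smul_scaledProduct hC, h, Matrix.mul_smul, smul_mul]

theorem rank_scaledProduct_of_eq_zero {m p : ℕ} (hp : p.Prime)
    {C : Matrix (Fin (m + 4)) (Fin (m + 4)) ℤ} (hC : C ∈ R0 (m + 4) p)
    (h : ∀ i j : Fin (m + 4), 1 ≤ i.val → i < j → j.val ≤ m + 4 - 2 → C i j = 0) :
    ((scaledProduct (m + 2) p C).map (Int.castRingHom (ZMod p))).rank = 1 := by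
  have : Fact p.Prime := ⟨hp⟩
  obtain ⟨hlow, -, -, hdiag, -⟩ := hC
  set A := (scaledProduct (m + 2) p C).map (Int.castRingHom (ZMod p)) with hA
  apply le_antisymm
  · have hAv : A = vecMulVec (Pi.single 0 1) (A 0) := by
      ext i j
      rw [vecMulVec_apply]
      by_cases hi : i = 0
      · simp [hi]
      · simp only [Pi.single_apply, hi, if_false, zero_mul]
        simp only [hA, scaledProduct, map_apply, of_apply, hi, if_false]
        split_ifs with h0 hl
        · simp
        · simp
        · rcases lt_trichotomy i j with hij | rfl | hij
          · rw [h i j (by have := Fin.pos_of_ne_zero hi; exact this) hij (by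
              have := Fin.lt_last_iff_ne_last.2 hl
              have := Fin.lt_def.1 this
              simp at this; omega)]
            simp
          · simp [hdiag]
          · simp [hlow i j hij]
    rw [hAv]
    exact rank_vecMulVec_le _ _
  · have hu : IsUnit (A.submatrix ![0] ![0]).det := by
      rw [det_fin_one]
      simp [hA, scaledProduct]
    have := rank_of_isUnit _ ((isUnit_iff_isUnit_det _).2 hu)
    rw [Fintype.card_fin] at this
    exact this.ge.trans <| rank_submatrix_le A ![0] ![0]

theorem rank_scaledProduct_of_ne_zero {m p : ℕ} (hp : p.Prime)
    {C : Matrix (Fin (m + 4)) (Fin (m + 4)) ℤ} (hC : C ∈ R0 (m + 4) p)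
    {a b : Fin (m + 4)} (ha : 1 ≤ a.val) (hab : a < b) (hb : b.val ≤ m + 4 - 2) (h : C a b ≠ 0) :
    ((scaledProduct (m + 2) p C).map (Int.castRingHom (ZMod p))).rank = 2 := by
  have : Fact p.Prime := ⟨hp⟩
  obtain ⟨hlow, hdiv, -, hdiag, hbd⟩ := hC
  set A := (scaledProduct (m + 2) p C).map (Int.castRingHom (ZMod p)) with hA
  have hc : (C a b : ZMod p) ≠ 0 := by
    rw [Ne, ZMod.intCast_zmod_eq_zero_iff_dvd]
    intro hd
    obtain ⟨h1, h2⟩ := hbd a b hab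
    exact h (Int.eq_zero_of_dvd_of_nonneg_of_lt h1 h2 hd)
  have ha0 : a ≠ 0 := by rintro rfl; simp at ha
  have hb0 : b ≠ 0 := by rintro rfl; simp at hab
  have hbl : b ≠ Fin.last _ := by rintro rfl; simp at hb
  apply le_antisymm
  · have hAv : A = Matrix.of (fun i k => ![if i = 0 then (1 : ZMod p) else 0, C i b] k) *
        Matrix.of (fun k j => ![if j = 0 then (1 : ZMod p) else 0,
          if j = 0 ∨ j = Fin.last _ then 0 else (C a b : ZMod p)⁻¹ * C a j] k) := by
      ext i j
      simp only [mul_apply, Fin.sum_univ_two, of_apply, hA, scaledProduct, map_apply]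
      by_cases hj : j = 0
      · simp [hj]
      · by_cases hl : j = Fin.last _
        · simp [hl]
        · have hd := detDiv_two_dvd C i a b j
          rw [hdiv 2 (by omega) (by omega), show 2 - 1 = 1 from rfl, pow_one] at hd
          have hd := (ZMod.intCast_zmod_eq_zero_iff_dvd _ p).2 hd
          push_cast at hd
          simp [hj, hl]
          field_simp
          linear_combination -hd
    rw [hAv]
    refine (rank_mul_le_left _ _).trans ((rank_le_card_width _).trans ?_)
    simp
  · have hu : IsUnit (A.submatrix ![0, a] ![0, b]).det := by
      rw [det_fin_two]
      simp [hA, scaledProduct, ha0, hb0, hbl, hc]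
    have := rank_of_isUnit _ ((isUnit_iff_isUnit_det _).2 hu)
    rw [Fintype.card_fin] at this
    exact this.ge.trans <| rank_submatrix_le A ![0, a] ![0, b]

theorem statement9 (n p : ℕ) (hn : 4 ≤ n) (hp : p.Prime)
    (C₀ : Matrix (Fin n) (Fin n) ℤ) (hC₀ : C₀ ∈ R0 n p) :
    ((∀ i j : Fin n, 1 ≤ i.val → i < j → j.val ≤ n - 2 → C₀ i j = 0) →
      toQ n (C₀ * Dmat n p) ∈ doubleCoset n (Matrix.diagonal fun i : Fin n =>
      if i.val = 0 then (p : ℚ) else if i.val = n - 1 then (p : ℚ) ^ 3 else (p : ℚ) ^ 2)) ∧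
    ((¬ ∀ i j : Fin n, 1 ≤ i.val → i < j → j.val ≤ n - 2 → C₀ i j = 0) →
      toQ n (C₀ * Dmat n p) ∈ doubleCoset n (Matrix.diagonal fun i : Fin n =>
      if i.val ≤ 1 then (p : ℚ) else if n - 2 ≤ i.val then (p : ℚ) ^ 3 else (p : ℚ) ^ 2)) := by
  obtain ⟨m, rfl⟩ := Nat.exists_eq_add_of_le' hn
  constructor
  · intro h
    convert scaledProduct_mem_doubleCoset hp hC₀
      (fun i => if i.val = 0 then 0 else if i.val = m + 3 then 2 else 1)
      (fun i => by split_ifs <;> omega) ?_ ?_ using 3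
    · ext i
      split_ifs <;> first | omega | norm_num
    · rw [Fin.sum_univ_succ, Fin.sum_univ_castSucc]
      simp [Fin.val_succ, (Fin.is_lt _).ne]
    · rw [rank_scaledProduct_of_eq_zero hp hC₀ h, eq_comm, Finset.card_eq_one]
      refine ⟨0, ?_⟩
      ext i
      simp only [Finset.mem_filter_univ, Finset.mem_singleton, Fin.ext_iff, Fin.val_zero]
      grind
  · intro h
    push Not at h
    obtain ⟨a, b, ha, hab, hb, h⟩ := h
    convert scaledProduct_mem_doubleCoset hp hC₀
      (fun i => if i.val ≤ 1 then 0 else if m + 2 ≤ i.val then 2 else 1)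
      (fun i => by split_ifs <;> omega) ?_ ?_ using 3
    · ext i
      split_ifs <;> first | omega | norm_num
    · rw [Fin.sum_univ_succ, Fin.sum_univ_succ, Fin.sum_univ_castSucc, Fin.sum_univ_castSucc]
      simp [Fin.val_succ, fun x : Fin m => Nat.not_le.2 x.is_lt]
    · rw [rank_scaledProduct_of_ne_zero hp hC₀ ha hab hb h, eq_comm, Finset.card_eq_two]
      refine ⟨0, 1, by simp, ?_⟩
      ext i
      simp only [Finset.mem_filter_univ, Finset.mem_insert, Finset.mem_singleton, Fin.ext_iff,
        Fin.val_zero, Fin.val_one]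
      grind
end

section
/- Let n ≥ 4 be an integer and p a prime. The number of matrices C₀ ∈ R₀^(n)(p) such that C₀·D^(n)(p) belongs to the double coset Λ_n diag(p, p², …, p², p³) Λ_n (with n−2 middle entries equal to p²) equals 2·p^{n−1} − p − 1. -/
open Matrix

/-- The matrices with diagonal entries `p` that vanish off the diagonal outside row `r`, and whose
off-diagonal entries in row `r` lie in `[0, p)`. -/
def rowSet (n p : ℕ) (r : Fin n) : Set (Matrix (Fin n) (Fin n) ℤ) :=
  {C | (∀ i, C i i = (p : ℤ)) ∧ (∀ i j, i ≠ j → i ≠ r → C i j = 0) ∧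
    (∀ j, j ≠ r → 0 ≤ C r j ∧ C r j < (p : ℤ))}

/-- The transposes of the matrices in `rowSet n p r`. -/
def colSet (n p : ℕ) (r : Fin n) : Set (Matrix (Fin n) (Fin n) ℤ) :=
  {C | Cᵀ ∈ rowSet n p r}

theorem ncard_rowSet (n p : ℕ) (r : Fin n) : (rowSet n p r).ncard = p ^ (n - 1) := by
  classical
  let φ : ({j : Fin n // j ≠ r} → Fin p) → Matrix (Fin n) (Fin n) ℤ := fun w =>
    Matrix.of fun i j => if h : i = r ∧ j ≠ r then ((w ⟨j, h.2⟩ : ℕ) : ℤ)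
      else if i = j then (p : ℤ) else 0
  have hφ : Function.Injective φ := by
    intro w w' h
    funext ⟨j, hj⟩
    have := congrFun (congrFun h r) j
    simpa [φ, hj, Fin.val_inj] using this
  have hr : rowSet n p r = Set.range φ := by
    ext C
    constructor
    · rintro ⟨h1, h2, h3⟩
      refine ⟨fun j => ⟨(C r j).toNat, by have := h3 j j.2; omega⟩, ?_⟩
      ext i j
      by_cases h : i = r ∧ j ≠ r
      · obtain ⟨rfl, hj⟩ := h
        have := h3 j hj
        simp [φ, hj, this.1]
      · by_cases hij : i = j
        · subst hij
          simp only [φ, Matrix.of_apply, dif_neg h, if_true, h1]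
        · have hi : i ≠ r := by
            rintro rfl
            exact h ⟨rfl, fun e => hij e.symm⟩
          simp only [φ, Matrix.of_apply, dif_neg h, if_neg hij, h2 i j hij hi]
    · rintro ⟨w, rfl⟩
      refine ⟨fun i => ?_, fun i j hij hi => ?_, fun j hj => ?_⟩
      · have : ¬ (i = r ∧ i ≠ r) := by tauto
        simp only [φ, Matrix.of_apply, dif_neg this, if_true]
      · simp [φ, hij, hi]
      · simp [φ, hj]
  rw [hr, ← Set.image_univ, Set.ncard_image_of_injective _ hφ, Set.ncard_univ, Nat.card_eq_fintype_card]
  simp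

theorem ncard_colSet (n p : ℕ) (r : Fin n) : (colSet n p r).ncard = p ^ (n - 1) := by
  have : colSet n p r = Matrix.transpose '' rowSet n p r := by
    ext C
    exact ⟨fun h => ⟨Cᵀ, h, Matrix.transpose_transpose C⟩,
      by rintro ⟨M, hM, rfl⟩; simpa [colSet] using hM⟩
  rw [this, Set.ncard_image_of_injective _ Matrix.transpose_injective, ncard_rowSet]

theorem ncard_rowSet_inter_colSet (n p : ℕ) {r c : Fin n} (hrc : r ≠ c) :
    (rowSet n p r ∩ colSet n p c).ncard = p := by
  let φ : Fin p → Matrix (Fin n) (Fin n) ℤ := fun x =>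
    Matrix.of fun i j => if i = r ∧ j = c then ((x : ℕ) : ℤ) else if i = j then (p : ℤ) else 0
  have hφ : Function.Injective φ := by
    intro w w' h
    have := congrFun (congrFun h r) c
    simpa [φ, Fin.val_inj] using this
  have hr : rowSet n p r ∩ colSet n p c = Set.range φ := by
    ext C
    constructor
    · rintro ⟨⟨h1, h2, h3⟩, -, h5, -⟩
      have h4 := h3 c hrc.symm
      refine ⟨⟨(C r c).toNat, by omega⟩, ?_⟩
      ext i j
      by_cases h : i = r ∧ j = c
      · obtain ⟨rfl, rfl⟩ := h
        simp [φ, h4.1]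
      · by_cases hij : i = j
        · subst hij
          simp only [φ, Matrix.of_apply, if_neg h, if_true, h1]
        · simp only [φ, Matrix.of_apply, if_neg h, if_neg hij]
          by_cases hi : i = r
          · exact (h5 j i (Ne.symm hij) (fun e => h ⟨hi, e⟩)).symm
          · exact (h2 i j hij hi).symm
    · rintro ⟨x, rfl⟩
      have hd : ∀ i, ¬ (i = r ∧ i = c) := fun i h => hrc (h.1.symm.trans h.2)
      have hx : ((x : ℕ) : ℤ) < p := by exact_mod_cast x.2
      have hp : (0 : ℤ) < p := by omega
      refine ⟨⟨fun i => by simp only [φ, Matrix.of_apply, if_neg (hd i), if_true],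
        fun i j hij hi => by simp [φ, hij, hi], fun j hj => ?_⟩,
        ⟨fun i => by simp only [φ, Matrix.transpose_apply, Matrix.of_apply, if_neg (hd i), if_true],
        fun i j hij hi => by simp [φ, hij.symm, hi], fun j hj => ?_⟩⟩
      · by_cases h : j = c
        · simp [φ, h]
        · simpa [φ, h, hj.symm] using hp
      · by_cases h : j = r
        · simp [φ, h]
        · simpa [φ, h, hj] using hp
  rw [hr, ← Set.image_univ, Set.ncard_image_of_injective _ hφ, Set.ncard_univ, Nat.card_eq_fintype_card]
  simp

theorem detDiv_nonneg (n k : ℕ) (C : Matrix (Fin n) (Fin n) ℤ) : 0 ≤ detDiv n k C := by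
  exact Int.nonneg_of_normalize_eq_self Finset.normalize_gcd

theorem dvd_detDiv {n k : ℕ} {C : Matrix (Fin n) (Fin n) ℤ} {d : ℤ}
    (h : ∀ f g : Fin k → Fin n, StrictMono f → StrictMono g → d ∣ (C.submatrix f g).det) :
    d ∣ detDiv n k C := by
  refine Finset.dvd_gcd fun fg hfg => ?_
  simp only [Finset.mem_filter, Finset.mem_univ, true_and] at hfg
  exact h _ _ (fun a b => hfg.1 a b) (fun a b => hfg.2 a b)

theorem detDiv_dvd_minor {n k : ℕ} (C : Matrix (Fin n) (Fin n) ℤ) (f g : Fin k → Fin n) :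
    detDiv n k C ∣ (C.submatrix f g).det := by
  by_cases hf : Function.Injective f
  swap
  · obtain ⟨a, b, hab, hne⟩ := by simpa [Function.Injective] using hf
    rw [Matrix.det_zero_of_row_eq hne (by ext j; simp [hab])]
    exact dvd_zero _
  by_cases hg : Function.Injective g
  swap
  · obtain ⟨a, b, hab, hne⟩ := by simpa [Function.Injective] using hg
    rw [Matrix.det_zero_of_column_eq hne (by intro j; simp [hab])]
    exact dvd_zero _
  have key : detDiv n k C ∣ (C.submatrix (f ∘ Tuple.sort f) (g ∘ Tuple.sort g)).det := by
    refine Finset.gcd_dvd (b := (f ∘ Tuple.sort f, g ∘ Tuple.sort g)) ?_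
    have h1 := (Tuple.monotone_sort f).strictMono_of_injective
      (hf.comp (Tuple.sort f).injective)
    have h2 := (Tuple.monotone_sort g).strictMono_of_injective
      (hg.comp (Tuple.sort g).injective)
    simp only [Finset.mem_filter, Finset.mem_univ, true_and]
    exact ⟨fun a b h => h1 h, fun a b h => h2 h⟩
  have e : C.submatrix (f ∘ Tuple.sort f) (g ∘ Tuple.sort g) =
      ((C.submatrix f g).submatrix (Tuple.sort f) id).submatrix id (Tuple.sort g) := rfl
  rw [e, Matrix.det_permute', Matrix.det_permute] at key
  have hu : ∀ σ : Equiv.Perm (Fin k), IsUnit (((Equiv.Perm.sign σ : ℤˣ) : ℤ)) :=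
    fun σ => Units.isUnit _
  exact (hu _).dvd_mul_left.1 ((hu _).dvd_mul_left.1 key)

theorem detDiv_transpose (n k : ℕ) (C : Matrix (Fin n) (Fin n) ℤ) :
    detDiv n k Cᵀ = detDiv n k C := by
  have aux : ∀ M : Matrix (Fin n) (Fin n) ℤ, detDiv n k M ∣ detDiv n k Mᵀ := fun M =>
    dvd_detDiv fun f g _ _ => by
      rw [← Matrix.transpose_submatrix, Matrix.det_transpose]
      exact detDiv_dvd_minor M g f
  exact Int.dvd_antisymm (detDiv_nonneg _ _ _) (detDiv_nonneg _ _ _)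
    (by simpa using aux Cᵀ) (aux C)

theorem exists_injective_notMem {n k : ℕ} (t : Finset (Fin n)) (h : k + t.card ≤ n) :
    ∃ s : Fin k → Fin n, Function.Injective s ∧ ∀ a, s a ∉ t := by
  have hk : k ≤ tᶜ.card := by
    rw [Finset.card_compl, Fintype.card_fin]
    omega
  exact ⟨_, (tᶜ.orderEmbOfCardLe hk).injective,
    fun a => Finset.mem_compl.1 (tᶜ.orderEmbOfCardLe_mem hk a)⟩

theorem pow_dvd_minor_of_mem_rowSet {n p k : ℕ} {r : Fin n} {C : Matrix (Fin n) (Fin n) ℤ}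
    (hC : C ∈ rowSet n p r) (f g : Fin k → Fin n) (hf : Function.Injective f) :
    (p : ℤ) ^ (k - 1) ∣ (C.submatrix f g).det := by
  obtain ⟨h1, h2, -⟩ := hC
  let c : Fin k → ℤ := fun a => if f a = r then 1 else p
  let M : Matrix (Fin k) (Fin k) ℤ := Matrix.of fun a b =>
    if f a = r then C r (g b) else if f a = g b then 1 else 0
  have e : C.submatrix f g = Matrix.of fun a b => c a * M a b := by
    ext a b
    by_cases ha : f a = r
    · simp [c, M, ha]
    · by_cases hb : f a = g b
      · simp [c, M, ← hb, ha, h1]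
      · simp [c, M, ha, hb, h2 _ _ hb ha]
  rw [e, Matrix.det_mul_column]
  refine Dvd.dvd.mul_right ?_ _
  simp only [c, Finset.prod_ite, Finset.prod_const, one_pow, one_mul]
  refine pow_dvd_pow _ ?_
  have h3 : (Finset.univ.filter fun a => f a = r).card ≤ 1 := by
    refine Finset.card_le_one.2 fun a ha b hb => hf ?_
    simp only [Finset.mem_filter, Finset.mem_univ, true_and] at ha hb
    rw [ha, hb]
  have h4 := Finset.card_filter_add_card_filter_not (s := (Finset.univ : Finset (Fin k)))
    (fun a => f a = r)
  rw [Finset.card_univ, Fintype.card_fin] at h4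
  omega

theorem detDiv_of_mem_rowSet {n p : ℕ} (hp : p.Prime) {r : Fin n}
    {C : Matrix (Fin n) (Fin n) ℤ} (hC : C ∈ rowSet n p r) (hne : ∃ j, j ≠ r ∧ C r j ≠ 0)
    {k : ℕ} (hk1 : 1 ≤ k) (hk : k ≤ n - 1) : detDiv n k C = (p : ℤ) ^ (k - 1) := by
  obtain ⟨j, hj, hCj⟩ := hne
  have hn : 0 < n := r.pos
  obtain ⟨k, rfl⟩ : ∃ l, k = l + 1 := ⟨k - 1, by omega⟩
  obtain ⟨h1, h2, h3⟩ := id hC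
  refine Int.dvd_antisymm (detDiv_nonneg _ _ _) (by positivity) ?_
    (dvd_detDiv fun f g hf _ => pow_dvd_minor_of_mem_rowSet hC f g hf.injective)
  have hA : detDiv n (k + 1) C ∣ (p : ℤ) ^ k * p := by
    obtain ⟨s, hs, hsr⟩ := exists_injective_notMem (k := k + 1) {r} (by simp; omega)
    convert detDiv_dvd_minor C s s using 1
    have : C.submatrix s s = Matrix.diagonal fun _ => (p : ℤ) := by
      ext a b
      by_cases hab : a = b
      · simp [hab, h1]
      · simp [hab, h2 _ _ (hs.ne hab) (by simpa using hsr a)]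
    rw [this, Matrix.det_diagonal]
    simp [pow_succ]
  have hB : detDiv n (k + 1) C ∣ (p : ℤ) ^ k * C r j := by
    obtain ⟨s, hs, hsr⟩ := exists_injective_notMem (k := k) {r, j}
      (by rw [Finset.card_pair hj.symm]; omega)
    simp only [Finset.mem_insert, Finset.mem_singleton, not_or] at hsr
    convert detDiv_dvd_minor C (Fin.cons r s : Fin (k + 1) → Fin n) (Fin.cons j s) using 1
    rw [Matrix.det_of_isUpperTriangular]
    · simp [Fin.prod_univ_succ, h1, mul_comm]
    · intro a b hab
      simp only [id] at hab
      obtain ⟨a, rfl⟩ := Fin.exists_succ_eq.2 (Fin.ne_zero_of_lt hab)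
      refine Fin.cases ?_ (fun b hab => ?_) b hab
      · intro _
        simpa using h2 _ _ (hsr a).2 (hsr a).1
      · simpa using h2 _ _ (hs.ne (Fin.succ_lt_succ_iff.1 hab).ne') (hsr a).1
  have hcop : IsCoprime (p : ℤ) (C r j) := by
    rw [Prime.coprime_iff_not_dvd (Nat.prime_iff_prime_int.1 hp)]
    intro hd
    have := h3 j hj
    exact absurd (Int.le_of_dvd (by omega) hd) (by omega)
  obtain ⟨x, y, hxy⟩ := hcop
  have : (p : ℤ) ^ k = x * (p ^ k * p) + y * (p ^ k * C r j) := by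
    linear_combination (-(p : ℤ) ^ k) * hxy
  rw [Nat.add_sub_cancel, this]
  exact dvd_add (hA.mul_left _) (hB.mul_left _)

theorem detDiv_self {n : ℕ} (C : Matrix (Fin n) (Fin n) ℤ) (h : 0 ≤ C.det) :
    detDiv n n C = C.det := by
  refine Int.dvd_antisymm (detDiv_nonneg _ _ _) h
    (by simpa using detDiv_dvd_minor C id id) (dvd_detDiv fun f g hf hg => ?_)
  have hid : ∀ f : Fin n → Fin n, StrictMono f → f = id := fun f hf => by
    refine (hf.range_inj strictMono_id).1 ?_
    rw [(Finite.injective_iff_surjective.1 hf.injective).range_eq, Set.range_id]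
  rw [hid f hf, hid g hg, Matrix.submatrix_id_id]

theorem Lambda_one_mem (n : ℕ) : (1 : Matrix (Fin n) (Fin n) ℚ) ∈ Lambda n :=
  ⟨fun i j => ⟨(1 : Matrix (Fin n) (Fin n) ℤ) i j, by
    by_cases h : i = j <;> simp [Matrix.one_apply, h]⟩, Or.inl Matrix.det_one⟩

theorem toQ_mem_doubleCoset {m p : ℕ} {C : Matrix (Fin (m + 2)) (Fin (m + 2)) ℤ}
    (hlow : ∀ i j, j < i → C i j = 0) (hd : ∀ i, C i i = (p : ℤ))
    (hmid : ∀ i j, i < j → i ≠ 0 → j ≠ Fin.last _ → C i j = 0) :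
    toQ (m + 2) (C * Dmat (m + 2) p) ∈ doubleCoset (m + 2) (Matrix.diagonal fun i : Fin (m + 2) =>
      if i.val = 0 then (p : ℚ) else if i.val = m + 2 - 1 then (p : ℚ) ^ 3 else (p : ℚ) ^ 2) := by
  let U : Matrix (Fin (m + 2)) (Fin (m + 2)) ℤ := Matrix.of fun i j =>
    if i = j then 1 else if i = 0 ∧ j = Fin.last _ then p * C i j else C i j
  have hlow' : ∀ i j, j < i → U i j = 0 := fun i j hij => by
    simp [U, hij.ne', hlow i j hij]
  refine ⟨1, Lambda_one_mem _, toQ _ U, ⟨fun i j => ⟨U i j, rfl⟩, Or.inl ?_⟩, ?_⟩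
  · rw [Matrix.det_of_isUpperTriangular]
    · simp [toQ, U]
    · intro i j hij
      simp [toQ, hlow' i j hij]
  · rw [one_mul]
    ext i j
    simp only [toQ, Matrix.map_apply, Dmat, Matrix.mul_diagonal, Matrix.diagonal_mul]
    have h0 : ∀ i : Fin (m + 2), i.val = 0 ↔ i = 0 := fun _ => Fin.val_eq_zero_iff
    have hl : ∀ i : Fin (m + 2), i.val = m + 2 - 1 ↔ i = Fin.last _ := fun i => by
      simp [Fin.ext_iff]
    have h0l : (0 : Fin (m + 2)) ≠ Fin.last _ := by simp [Fin.ext_iff]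
    simp only [h0, hl]
    rcases lt_trichotomy i j with hij | rfl | hij
    · have hj : j ≠ 0 := Fin.ne_zero_of_lt hij
      have hi : i ≠ Fin.last _ := Fin.ne_last_of_lt hij
      by_cases hi0 : i = 0 <;> by_cases hjl : j = Fin.last _
      · subst hi0 hjl
        simp [U, h0l, h0l.symm]
        ring
      · simp [U, hj, hjl, hi0, hj.symm]
        ring
      · simp [U, hi0, hjl, h0l.symm, hi]
        ring
      · simp [U, hij.ne, hi0, hmid i j hij hi0 hjl]
    · by_cases hi0 : i = 0
      · simp [U, hi0, hd]
      · by_cases hil : i = Fin.last _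
        · simp [U, hil, h0l.symm, hd]
          ring
        · simp [U, hi0, hil, hd]
          ring
    · simp [hlow i j hij, hlow' i j hij]

theorem dvd_of_toQ_mem_doubleCoset {m p : ℕ} (hp : p ≠ 0)
    {C : Matrix (Fin (m + 2)) (Fin (m + 2)) ℤ}
    (hlow : ∀ i j, j < i → C i j = 0) (hd : ∀ i, C i i = (p : ℤ))
    (hC : toQ (m + 2) (C * Dmat (m + 2) p) ∈ doubleCoset (m + 2)
      (Matrix.diagonal fun i : Fin (m + 2) =>
      if i.val = 0 then (p : ℚ) else if i.val = m + 2 - 1 then (p : ℚ) ^ 3 else (p : ℚ) ^ 2))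
    {i j : Fin (m + 2)} (hi : i ≠ 0) (hj0 : j ≠ 0) (hj : j ≠ Fin.last _) : (p : ℤ) ∣ C i j := by
  obtain ⟨γ₁, ⟨h1, -⟩, γ₂, ⟨h2, -⟩, h⟩ := hC
  choose u hu using h1
  choose v hv using h2
  have h0l : (0 : Fin (m + 2)) ≠ Fin.last _ := by simp [Fin.ext_iff]
  have key : ∀ i j, ∃ t : ℤ, (C * Dmat (m + 2) p) i j = p * (u i 0 * v 0 j + p * t) := by
    intro i j
    refine ⟨∑ k : Fin (m + 1), u i k.succ * (if k = Fin.last _ then (p : ℤ) else 1) * v k.succ j, ?_⟩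
    have := congrFun (congrFun h i) j
    rw [Matrix.mul_apply, Fin.sum_univ_succ] at this
    simp only [Matrix.mul_diagonal, hu, hv, toQ, Matrix.map_apply] at this
    have h' : (((C * Dmat (m + 2) p) i j : ℤ) : ℚ) = ((p * (u i 0 * v 0 j + p *
        ∑ k : Fin (m + 1), u i k.succ * (if k = Fin.last _ then (p : ℤ) else 1) * v k.succ j) : ℤ) : ℚ) := by
      rw [this]
      push_cast
      rw [mul_add, Finset.mul_sum, Finset.mul_sum]
      refine congrArg₂ _ (by simp; ring) (Finset.sum_congr rfl fun k _ => ?_)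
      by_cases hk : k = Fin.last _
      · simp [hk]
        ring
      · have : (k : ℕ) ≠ m := fun e => hk (Fin.ext e)
        simp [hk, this]
        ring
    exact_mod_cast h'
  have hpz : (p : ℤ) ≠ 0 := by exact_mod_cast hp
  obtain ⟨a, ha⟩ := key 0 0
  obtain ⟨b, hb⟩ := key i 0
  obtain ⟨c, hc⟩ := key i j
  have hjv : (j : ℕ) ≠ m + 1 := fun e => hj (Fin.ext e)
  simp only [Dmat, Matrix.mul_diagonal] at ha hb hc
  rw [hlow i 0 (Fin.pos_of_ne_zero hi)] at hb
  simp [hd, hj0, hjv] at ha hb hc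
  rw [mul_comm] at hc
  have hc' := mul_left_cancel₀ hpz hc
  have ha' : 1 = u 0 0 * v 0 0 + p * a := mul_left_cancel₀ hpz (by linarith)
  have hb' := hb.resolve_left hp
  exact ⟨c + u i 0 * v 0 j * a - u 0 0 * v 0 j * b, by
    linear_combination hc' + u i 0 * v 0 j * ha' + u 0 0 * v 0 j * hb'⟩

theorem setOf_R0_mem_doubleCoset {m p : ℕ} (hm : 1 ≤ m) (hp : p.Prime) :
    {C₀ ∈ R0 (m + 2) p | toQ (m + 2) (C₀ * Dmat (m + 2) p) ∈ doubleCoset (m + 2)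
      (Matrix.diagonal fun i : Fin (m + 2) =>
      if i.val = 0 then (p : ℚ) else if i.val = m + 2 - 1 then (p : ℚ) ^ 3 else (p : ℚ) ^ 2)} =
    (rowSet (m + 2) p 0 ∪ colSet (m + 2) p (Fin.last _)) \ {Matrix.diagonal fun _ => (p : ℤ)} := by
  have hpz : Prime (p : ℤ) := Nat.prime_iff_prime_int.1 hp
  ext C
  constructor
  · rintro ⟨⟨hlow, hdiv, -, hd, hb⟩, hC⟩
    have hzero : ∀ i j, i < j → (p : ℤ) ∣ C i j → C i j = 0 := fun i j hij hdv =>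
      Int.eq_zero_of_dvd_of_nonneg_of_lt (hb i j hij).1 (hb i j hij).2 hdv
    have hmid : ∀ i j, i ≠ j → i ≠ 0 → j ≠ Fin.last _ → C i j = 0 := by
      intro i j hij hi hj
      rcases lt_or_gt_of_ne hij with hij | hij
      · exact hzero i j hij (dvd_of_toQ_mem_doubleCoset hp.ne_zero hlow hd hC hi
          (Fin.ne_zero_of_lt hij) hj)
      · exact hlow i j hij
    have hprod : ∀ i j, i ≠ 0 → i ≠ Fin.last _ → j ≠ 0 → j ≠ Fin.last _ →
        C 0 j = 0 ∨ C i (Fin.last _) = 0 := by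
      intro i j hi hil hj hjl
      have h := detDiv_dvd_minor C ![0, i] ![j, Fin.last _]
      rw [hdiv 2 (by omega) (by omega), Matrix.det_fin_two] at h
      simp only [Matrix.submatrix_apply, Matrix.cons_val_zero, Matrix.cons_val_one] at h
      have hij : (p : ℤ) ∣ C i j := by
        by_cases e : i = j
        · rw [e, hd]
        · rw [hmid i j e hi hjl]
          exact dvd_zero _
      have h' := (dvd_sub_left (hij.mul_left (C 0 (Fin.last _)))).1 (by simpa using h)
      exact (hpz.dvd_or_dvd h').imp (hzero _ _ (Fin.pos_of_ne_zero hj))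
        (hzero _ _ (Fin.lt_last_iff_ne_last.2 hil))
    constructor
    · by_cases hrow : ∀ j, j ≠ 0 → j ≠ Fin.last _ → C 0 j = 0
      · right
        refine ⟨hd, fun i j hij hi => ?_, fun j hj => hb _ _ (Fin.lt_last_iff_ne_last.2 hj)⟩
        rw [Matrix.transpose_apply]
        by_cases hj : j = 0
        · subst hj
          exact hrow i hij hi
        · exact hmid j i hij.symm hj hi
      · left
        push Not at hrow
        obtain ⟨j₀, hj0, hjl, hne⟩ := hrow
        refine ⟨hd, fun i j hij hi => ?_, fun j hj => hb _ _ (Fin.pos_of_ne_zero hj)⟩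
        by_cases hj : j = Fin.last _
        · subst hj
          exact (hprod i j₀ hi hij hj0 hjl).resolve_left hne
        · exact hmid i j hij hi hj
    · rintro rfl
      have h1 := hdiv 1 le_rfl (by omega)
      have : (p : ℤ) ∣ 1 := by
        rw [← pow_zero (p : ℤ), ← Nat.sub_self 1, ← h1]
        refine dvd_detDiv fun f g _ _ => ?_
        rw [Matrix.det_fin_one, Matrix.submatrix_apply, Matrix.diagonal_apply]
        split_ifs <;> simp
      exact hpz.not_isUnit (isUnit_of_dvd_one this)
  · rintro ⟨hC, hne⟩
    have hd : ∀ i, C i i = (p : ℤ) := fun i => by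
      rcases hC with h | h
      · exact h.1 i
      · exact h.1 i
    have hlow : ∀ i j, j < i → C i j = 0 := fun i j hij => by
      rcases hC with h | h
      · exact h.2.1 i j hij.ne' (Fin.ne_zero_of_lt hij)
      · exact h.2.1 j i hij.ne (Fin.ne_last_of_lt hij)
    have hmid : ∀ i j, i < j → i ≠ 0 → j ≠ Fin.last _ → C i j = 0 := fun i j hij hi hj => by
      rcases hC with h | h
      · exact h.2.1 i j hij.ne hi
      · exact h.2.1 j i hij.ne' hj
    have hp0 : (0 : ℤ) < p := by exact_mod_cast hp.pos
    have hdet : C.det = (p : ℤ) ^ (m + 2) := by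
      rw [Matrix.det_of_isUpperTriangular (fun i j hij => hlow i j hij)]
      simp [hd]
    refine ⟨⟨hlow, fun k hk1 hk => ?_, ?_, hd, fun i j hij => ?_⟩,
      toQ_mem_doubleCoset hlow hd hmid⟩
    · rcases hC with h | h
      · refine detDiv_of_mem_rowSet hp h ?_ hk1 hk
        by_contra! hz
        refine hne (Matrix.ext fun i j => ?_)
        by_cases hij : i = j
        · simp [hij, hd]
        · rw [Matrix.diagonal_apply_ne _ hij]
          by_cases hi : i = 0
          · subst hi
            exact hz j (Ne.symm hij)
          · exact h.2.1 i j hij hi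
      · rw [← detDiv_transpose]
        refine detDiv_of_mem_rowSet hp h ?_ hk1 hk
        by_contra! hz
        refine hne (Matrix.ext fun i j => ?_)
        by_cases hij : i = j
        · simp [hij, hd]
        · rw [Matrix.diagonal_apply_ne _ hij]
          by_cases hj : j = Fin.last _
          · subst hj
            exact hz i hij
          · exact h.2.1 j i (Ne.symm hij) hj
    · rw [detDiv_self C (by rw [hdet]; positivity), hdet]
    · rcases hC with h | h
      · by_cases hi : i = 0
        · subst hi
          exact h.2.2 j hij.ne'
        · rw [h.2.1 i j hij.ne hi]
          exact ⟨le_rfl, hp0⟩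
      · by_cases hj : j = Fin.last _
        · subst hj
          exact h.2.2 i hij.ne
        · have e : C i j = 0 := h.2.1 j i hij.ne' hj
          rw [e]
          exact ⟨le_rfl, hp0⟩

theorem statement10 (n p : ℕ) (hn : 4 ≤ n) (hp : p.Prime) :
    {C₀ ∈ R0 n p | toQ n (C₀ * Dmat n p) ∈ doubleCoset n (Matrix.diagonal fun i : Fin n =>
      if i.val = 0 then (p : ℚ) else if i.val = n - 1 then (p : ℚ) ^ 3 else (p : ℚ) ^ 2)}.ncard =
      2 * p ^ (n - 1) - p - 1 := by
  obtain ⟨m, rfl⟩ : ∃ m, n = m + 2 := ⟨n - 2, by omega⟩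
  have hp0 : (0 : ℤ) < p := by exact_mod_cast hp.pos
  have h0l : (0 : Fin (m + 2)) ≠ Fin.last _ := by simp [Fin.ext_iff]
  have hmem : (Matrix.diagonal fun _ => (p : ℤ)) ∈ rowSet (m + 2) p 0 :=
    ⟨fun i => by simp, fun i j hij _ => Matrix.diagonal_apply_ne _ hij,
      fun j hj => by simp [Matrix.diagonal_apply_ne _ hj.symm, hp.pos]⟩
  have hpow : p ^ (m + 2 - 1) ≠ 0 := pow_ne_zero _ hp.ne_zero
  have hfin : ∀ S : Set (Matrix (Fin (m + 2)) (Fin (m + 2)) ℤ),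
      S.ncard = p ^ (m + 2 - 1) → S.Finite := fun S hS =>
    Set.finite_of_ncard_ne_zero (by rw [hS]; exact hpow)
  have hr := ncard_rowSet (m + 2) p 0
  have hc := ncard_colSet (m + 2) p (Fin.last _)
  have hu := Set.ncard_union_add_ncard_inter (rowSet (m + 2) p 0) (colSet (m + 2) p (Fin.last _))
    (hfin _ hr) (hfin _ hc)
  rw [ncard_rowSet_inter_colSet _ _ h0l, hr, hc] at hu
  rw [setOf_R0_mem_doubleCoset (by omega) hp, Set.ncard_sdiff_singleton_of_mem (Set.mem_union_left _ hmem)]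
  omega
end

section
/- Let n ≥ 4 and 2 ≤ k ≤ n−2 be integers and p a prime. Let C = [c_{i,j}] be an upper-triangular n×n integer matrix with c_{i,i} = p for all 1 ≤ i ≤ n, and such that c_{i,j}·c_{r,ℓ} = 0 for all indices with 1 ≤ i < j ≤ r < ℓ ≤ n. Then for every pair of indices (i₀, j₀) with 2 ≤ i₀ < j₀ ≤ n−1, there exist subsets ω and τ of {1, …, n} each of cardinality k and a sign ε ∈ {1, −1} such that the k×k minor of the product matrix C·D^(n)(p) with row indices ω and column indices τ equals ε·p^{2k−2}·c_{i₀,j₀}. -/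
open Matrix

theorem Equiv.Perm.eq_one_of_apply_le {k : ℕ} (σ : Equiv.Perm (Fin k)) (h : ∀ a, σ a ≤ a) :
    σ = 1 := by
  have hsum : ∑ a, (σ a : ℕ) = ∑ a : Fin k, (a : ℕ) := Equiv.sum_comp σ fun a => (a : ℕ)
  have heq := (Finset.sum_eq_sum_iff_of_le fun a _ => Fin.le_def.1 (h a)).1 hsum
  ext a
  simpa using heq a (Finset.mem_univ a)

/-- For an upper triangular matrix with constant diagonal `d` in which products of consecutive
strictly upper entries vanish, replacing a single column of a principal submatrix leaves only the
diagonal term in the determinant. -/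
theorem Matrix.det_submatrix_update {R ι : Type*} [CommRing R] [IsDomain R] [LinearOrder ι]
    {k : ℕ} (C : Matrix ι ι R) (d : R) (hut : ∀ i j, j < i → C i j = 0)
    (hdiag : ∀ i, C i i = d) (hvan : ∀ i j l, i < j → j < l → C i j * C j l = 0)
    (ω : Fin k → ι) (hω : StrictMono ω) (a₀ : Fin k) (j₀ : ι) (hj₀ : ∀ a, ω a ≠ j₀) :
    (C.submatrix ω (Function.update ω a₀ j₀)).det = d ^ (k - 1) * C (ω a₀) j₀ := by
  rw [Matrix.det_apply, Finset.sum_eq_single 1]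
  · rw [← Finset.mul_prod_erase _ _ (Finset.mem_univ a₀)]
    have hprod : ∏ x ∈ Finset.univ.erase a₀,
        C.submatrix ω (Function.update ω a₀ j₀) ((1 : Equiv.Perm (Fin k)) x) x = d ^ (k - 1) := by
      rw [Finset.prod_congr rfl (g := fun _ => d)]
      · simp
      · intro x hx
        simp [Function.update_of_ne (Finset.ne_of_mem_erase hx), hdiag]
    rw [hprod]
    simp [mul_comm]
  · intro σ _ hσ
    suffices h : ∏ a, C.submatrix ω (Function.update ω a₀ j₀) (σ a) a = 0 by rw [h, smul_zero]
    by_contra hne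
    have hfac : ∀ a, C (ω (σ a)) (Function.update ω a₀ j₀ a) ≠ 0 := fun a =>
      Finset.prod_ne_zero_iff.1 hne a (Finset.mem_univ a)
    have hle : ∀ a, ω (σ a) ≤ Function.update ω a₀ j₀ a := fun a =>
      not_lt.1 fun h => hfac a (hut _ _ h)
    by_cases hfix : σ a₀ = a₀
    · refine hσ (σ.eq_one_of_apply_le fun a => ?_)
      rcases eq_or_ne a a₀ with rfl | ha
      · exact hfix.le
      · simpa [Function.update_of_ne ha, hω.le_iff_le] using hle a
    · obtain ⟨a, ha⟩ := σ.surjective a₀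
      obtain ⟨c, hc⟩ := σ.surjective a
      have ha₀ : a ≠ a₀ := by rintro rfl; exact hfix ha
      have hca : Function.update ω a₀ j₀ c ≠ ω a := by
        rcases eq_or_ne c a₀ with rfl | hc₀
        · simpa using (hj₀ a).symm
        · rw [Function.update_of_ne hc₀]
          intro h
          obtain rfl := hω.injective h
          exact ha₀ (hc.symm.trans ha)
      have h₁ := hfac a
      have h₂ := hfac c
      have hle₁ := hle a
      have hle₂ := hle c
      rw [ha, Function.update_of_ne ha₀] at h₁ hle₁
      rw [hc] at h₂ hle₂
      exact mul_ne_zero h₁ h₂ (hvan _ _ _ (lt_of_le_of_ne hle₁ (hω.injective.ne ha₀.symm))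
        (lt_of_le_of_ne hle₂ hca.symm))
  · simp

theorem statement13 (n k p : ℕ) (hn : 4 ≤ n) (hk : 2 ≤ k) (hkn : k ≤ n - 2)
    (hp : p.Prime) (C : Matrix (Fin n) (Fin n) ℤ)
    (hut : ∀ i j : Fin n, j < i → C i j = 0)
    (hdiag : ∀ i : Fin n, C i i = (p : ℤ))
    (hvan : ∀ i j r l : Fin n, i < j → j ≤ r → r < l → C i j * C r l = 0)
    (i₀ j₀ : Fin n) (hi₀ : 1 ≤ i₀.val) (hij : i₀ < j₀) (hj₀ : j₀.val ≤ n - 2) :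
    ∃ (ω τ : Fin k → Fin n), StrictMono ω ∧ StrictMono τ ∧
      ∃ ε : ℤ, (ε = 1 ∨ ε = -1) ∧
        ((C * Dmat n p).submatrix ω τ).det = ε * (p : ℤ) ^ (2 * k - 2) * C i₀ j₀ := by
  let z : Fin n := ⟨0, by omega⟩
  let w : Fin n := ⟨n - 1, by omega⟩
  have hcard : k - 2 ≤ (Finset.univ \ {z, w, i₀, j₀} : Finset (Fin n)).card := by
    have h₁ := Finset.le_card_sdiff ({z, w, i₀, j₀} : Finset (Fin n)) Finset.univ
    have h₂ := Finset.card_le_four (a := z) (b := w) (c := i₀) (d := j₀)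
    rw [Finset.card_univ, Fintype.card_fin] at h₁
    omega
  obtain ⟨T, hT, hTk⟩ := Finset.exists_subset_card_eq hcard
  have hmem : ∀ x ∈ T, x ≠ z ∧ x ≠ w ∧ x ≠ i₀ ∧ x ≠ j₀ := fun x hx => by
    simpa [not_or] using hT hx
  have hzT : z ∉ T := fun h => (hmem z h).1 rfl
  have hiT : i₀ ∉ T := fun h => (hmem i₀ h).2.2.1 rfl
  have hjT : j₀ ∉ T := fun h => (hmem j₀ h).2.2.2 rfl
  have hij' : i₀.val < j₀.val := hij
  have hiz : i₀ ≠ z := by rw [Ne, Fin.ext_iff]; simp only [z]; omega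
  have hjz : j₀ ≠ z := by rw [Ne, Fin.ext_iff]; simp only [z]; omega
  have hiS : i₀ ∉ insert z T := by simp [hiz, hiT]
  have hjS : j₀ ∉ insert z T := by simp [hjz, hjT]
  have hAk : (insert i₀ (insert z T)).card = k := by
    rw [Finset.card_insert_of_notMem hiS, Finset.card_insert_of_notMem hzT]; omega
  have hBk : (insert j₀ (insert z T)).card = k := by
    rw [Finset.card_insert_of_notMem hjS, Finset.card_insert_of_notMem hzT]; omega
  let ω := (insert i₀ (insert z T)).orderEmbOfFin hAk
  let τ := (insert j₀ (insert z T)).orderEmbOfFin hBk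
  have hωr : ∀ x, x ∈ insert i₀ (insert z T) ↔ ∃ a, ω a = x := fun x => by
    rw [← Set.mem_range, Finset.range_orderEmbOfFin, Finset.mem_coe]
  have hτr : ∀ x, x ∈ insert j₀ (insert z T) ↔ ∃ a, τ a = x := fun x => by
    rw [← Set.mem_range, Finset.range_orderEmbOfFin, Finset.mem_coe]
  obtain ⟨a₀, ha₀⟩ := (hωr i₀).1 (Finset.mem_insert_self _ _)
  have hωj : ∀ a, ω a ≠ j₀ := fun a h => by
    have := (hωr j₀).2 ⟨a, h⟩
    rw [Finset.mem_insert] at this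
    exact this.elim hij.ne' hjS
  have hlift : ∀ a, ∃ b, τ b = Function.update ω a₀ j₀ a := fun a => by
    rw [← hτr]
    rcases eq_or_ne a a₀ with rfl | ha
    · simp
    · rw [Function.update_of_ne ha]
      refine Finset.mem_insert_of_mem
        (Finset.mem_of_mem_insert_of_ne ((hωr _).2 ⟨a, rfl⟩) fun h => ha ?_)
      exact ω.injective (h.trans ha₀.symm)
  choose f hf using hlift
  have hfinj : Function.Injective f := fun a b hab => by
    have h : Function.update ω a₀ j₀ a = Function.update ω a₀ j₀ b := by rw [← hf, ← hf, hab]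
    rcases eq_or_ne a a₀ with ha | ha <;> rcases eq_or_ne b a₀ with hb | hb
    · exact ha.trans hb.symm
    · rw [ha, Function.update_self, Function.update_of_ne hb] at h
      exact absurd h.symm (hωj b)
    · rw [hb, Function.update_self, Function.update_of_ne ha] at h
      exact absurd h (hωj a)
    · rw [Function.update_of_ne ha, Function.update_of_ne hb] at h
      exact ω.injective h
  let e : Equiv.Perm (Fin k) := Equiv.ofBijective f (Finite.injective_iff_bijective.1 hfinj)
  have hdet := Matrix.det_submatrix_update C p hut hdiag
    (fun i j l hij hjl => hvan i j j l hij le_rfl hjl) ω ω.strictMono a₀ j₀ hωj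
  have hupd : C.submatrix ω (Function.update ω a₀ j₀) = (C.submatrix ω τ).submatrix id e := by
    ext a b
    simp [e, hf]
  rw [hupd, Matrix.det_permute', ha₀] at hdet
  let d : Fin n → ℤ := fun i => if i.val = 0 then 1 else if i.val = n - 1 then (p : ℤ) ^ 2 else p
  have hD : (C * Dmat n p).submatrix ω τ
      = C.submatrix ω τ * Matrix.diagonal (fun b => d (τ b)) := by
    ext a b
    simp [Dmat, d, Matrix.mul_diagonal]
  have hd : ∀ x : Fin n, x ≠ z → x ≠ w → d x = p := fun x hxz hxw => by
    rw [Ne, Fin.ext_iff] at hxz hxw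
    simp only [d]
    rw [if_neg hxz, if_neg hxw]
  have hdprod : ∏ b, d (τ b) = (p : ℤ) ^ (k - 1) := by
    have himg : Finset.univ.image τ = insert j₀ (insert z T) := by
      ext x
      simp [hτr x]
    have hjw : j₀ ≠ w := by rw [Ne, Fin.ext_iff]; simp only [w]; omega
    rw [← Finset.prod_image (g := τ) (f := d) τ.injective.injOn, himg, Finset.prod_insert hjS,
      Finset.prod_insert hzT, hd j₀ hjz hjw,
      Finset.prod_congr rfl fun x hx => hd x (hmem x hx).1 (hmem x hx).2.1, Finset.prod_const, hTk,
      show d z = 1 from if_pos rfl, one_mul, ← pow_succ']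
    congr 1
    omega
  refine ⟨ω, τ, ω.strictMono, τ.strictMono, (Equiv.Perm.sign e : ℤ), ?_, ?_⟩
  · rcases Int.units_eq_one_or (Equiv.Perm.sign e) with h | h <;> simp [h]
  · have hsq : ((Equiv.Perm.sign e : ℤ)) * (Equiv.Perm.sign e : ℤ) = 1 := by
      rw [← Units.val_mul, Int.units_mul_self, Units.val_one]
    have hpow : (p : ℤ) ^ (2 * k - 2) = (p : ℤ) ^ (k - 1) * (p : ℤ) ^ (k - 1) := by
      rw [← pow_add]
      congr 1
      omega
    rw [hD, Matrix.det_mul, Matrix.det_diagonal, hdprod, hpow]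
    push_cast at hdet
    linear_combination (-(C.submatrix ω τ).det * (p : ℤ) ^ (k - 1)) * hsq
      + ((Equiv.Perm.sign e : ℤ) * (p : ℤ) ^ (k - 1)) * hdet
end
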